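/- Let Ω ⊆ ℝⁿ be open, α ∈ ℝ, and let Φ : Ω → ℝ be smooth and convex with positive definite Hessian satisfying det D²Φ(x) = e^{−αΦ(x)} on Ω (this is the transport setting with V = αΦ, W = 0). Then the weighted tensor Laplacian of the Calabi tensor g satisfies, for every x ∈ Ω: (Lg)_{ij} = Σ_k [ g_{ki} Φ^{km} (Ric_μ)_{mj} + g_{kj} Φ^{km} (Ric_μ)_{mi} ] + 2 Σ N_{piab} N_{qjcd} Φ^{pq} Φ^{ac} Φ^{bd} + 8 Σ R_{iabc} R_{jpqr} Φ^{ap} Φ^{bq} Φ^{cr}, where (Ric_μ)_{ij} := ¼ g_{ij} + (α/2) Φ_{ij}. In particular, the matrix with entries (Lg)_{ij} − Σ [ g_{ki} Φ^{km} (Ric_μ)_{mj} + g_{kj} Φ^{km} (Ric_μ)_{mi} ] is positive semidefinite at every x ∈ Ω (i.e. Lg ≥ 2 g ⊙ Ric_μ). -/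

import Mathlib

noncomputable section
open scoped BigOperators
open Filter MeasureTheory

/-- Partial derivative `∂_i f`. -/
def pd {n : ℕ} (f : (Fin n → ℝ) → ℝ) (i : Fin n) : (Fin n → ℝ) → ℝ :=
  fun x => fderiv ℝ f x (Pi.single i 1)

/-- Second partial derivative `f_{ij}`. -/
def pd2 {n : ℕ} (f : (Fin n → ℝ) → ℝ) (i j : Fin n) : (Fin n → ℝ) → ℝ :=
  pd (pd f i) j

/-- Third partial derivative `f_{ijk}`. -/
def pd3 {n : ℕ} (f : (Fin n → ℝ) → ℝ) (i j k : Fin n) : (Fin n → ℝ) → ℝ :=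
  pd (pd2 f i j) k

/-- Fourth partial derivative `f_{ijkl}`. -/
def pd4 {n : ℕ} (f : (Fin n → ℝ) → ℝ) (i j k l : Fin n) : (Fin n → ℝ) → ℝ :=
  pd (pd3 f i j k) l

/-- Fifth partial derivative. -/
def pd5 {n : ℕ} (f : (Fin n → ℝ) → ℝ) (i j k l m : Fin n) : (Fin n → ℝ) → ℝ :=
  pd (pd4 f i j k l) m

/-- The Hessian matrix `D²Φ(x)`, with entries `Φ_{ij}(x)`. -/
def hess {n : ℕ} (Φ : (Fin n → ℝ) → ℝ) (x : Fin n → ℝ) : Matrix (Fin n) (Fin n) ℝ :=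
  Matrix.of fun i j => pd2 Φ i j x

/-- The inverse Hessian matrix, with entries `Φ^{ij}(x)`. -/
def ihess {n : ℕ} (Φ : (Fin n → ℝ) → ℝ) (x : Fin n → ℝ) : Matrix (Fin n) (Fin n) ℝ :=
  (hess Φ x)⁻¹

/-- The gradient `∇Φ(x)`. -/
def grad {n : ℕ} (Φ : (Fin n → ℝ) → ℝ) (x : Fin n → ℝ) : Fin n → ℝ :=
  fun i => pd Φ i x

/-- The Calabi tensor `g_{ij} = Σ Φ_{iab} Φ_{jcd} Φ^{ac} Φ^{bd}`. -/
def calabi {n : ℕ} (Φ : (Fin n → ℝ) → ℝ) (i j : Fin n) (x : Fin n → ℝ) : ℝ :=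
  ∑ a, ∑ b, ∑ c, ∑ d,
    pd3 Φ i a b x * pd3 Φ j c d x * ihess Φ x a c * ihess Φ x b d

/-- `W^i := (∂_i W)(∇Φ)`. -/
def Wop {n : ℕ} (Φ W : (Fin n → ℝ) → ℝ) (i : Fin n) (x : Fin n → ℝ) : ℝ :=
  pd W i (grad Φ x)

/-- `Ŵ_{ij} := Σ_{a,b} W^{ab} Φ_{ai} Φ_{bj}` where `W^{ab} = (∂²_{ab}W)(∇Φ)`. -/
def What2 {n : ℕ} (Φ W : (Fin n → ℝ) → ℝ) (i j : Fin n) (x : Fin n → ℝ) : ℝ :=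
  ∑ a, ∑ b, pd2 W a b (grad Φ x) * pd2 Φ a i x * pd2 Φ b j x

/-- `Ŵ_{ijk} := Σ_{a,b,c} W^{abc} Φ_{ai} Φ_{bj} Φ_{ck}` where `W^{abc} = (∂³_{abc}W)(∇Φ)`. -/
def What3 {n : ℕ} (Φ W : (Fin n → ℝ) → ℝ) (i j k : Fin n) (x : Fin n → ℝ) : ℝ :=
  ∑ a, ∑ b, ∑ c, pd3 W a b c (grad Φ x) * pd2 Φ a i x * pd2 Φ b j x * pd2 Φ c k x

/-- Christoffel symbols `Γ^k_{pq} = ½ Σ_m Φ^{km} Φ_{mpq}` of the Hessian metric. -/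
def Γh {n : ℕ} (Φ : (Fin n → ℝ) → ℝ) (k p q : Fin n) (x : Fin n → ℝ) : ℝ :=
  (1/2) * ∑ m, ihess Φ x k m * pd3 Φ m p q x

/-- Covariant derivative of a (0,1)-tensor: `(∇T)_{p i}`. -/
def covD1 {n : ℕ} (Φ : (Fin n → ℝ) → ℝ) (T : Fin n → (Fin n → ℝ) → ℝ)
    (p i : Fin n) (x : Fin n → ℝ) : ℝ :=
  pd (T i) p x - ∑ m, Γh Φ m p i x * T m x

/-- Covariant derivative of a (0,2)-tensor: `(∇T)_{p i j}`. -/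
def covD2 {n : ℕ} (Φ : (Fin n → ℝ) → ℝ) (T : Fin n → Fin n → (Fin n → ℝ) → ℝ)
    (p i j : Fin n) (x : Fin n → ℝ) : ℝ :=
  pd (T i j) p x - ∑ m, Γh Φ m p i x * T m j x - ∑ m, Γh Φ m p j x * T i m x

/-- Covariant derivative of a (0,3)-tensor: `(∇T)_{p i j k}`. -/
def covD3 {n : ℕ} (Φ : (Fin n → ℝ) → ℝ) (T : Fin n → Fin n → Fin n → (Fin n → ℝ) → ℝ)
    (p i j k : Fin n) (x : Fin n → ℝ) : ℝ :=
  pd (T i j k) p x - ∑ m, Γh Φ m p i x * T m j k x - ∑ m, Γh Φ m p j x * T i m k x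
    - ∑ m, Γh Φ m p k x * T i j m x

/-- Covariant derivative of a (0,4)-tensor: `(∇T)_{p i j k l}`. -/
def covD4 {n : ℕ} (Φ : (Fin n → ℝ) → ℝ)
    (T : Fin n → Fin n → Fin n → Fin n → (Fin n → ℝ) → ℝ)
    (p i j k l : Fin n) (x : Fin n → ℝ) : ℝ :=
  pd (T i j k l) p x - ∑ m, Γh Φ m p i x * T m j k l x - ∑ m, Γh Φ m p j x * T i m k l x
    - ∑ m, Γh Φ m p k x * T i j m l x - ∑ m, Γh Φ m p l x * T i j k m x

/-- Weighted tensor Laplacian of a (0,1)-tensor: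
`(LT)_i = Σ Φ^{pq}(∇∇T)_{pq i} − ½ Σ_p (Σ_m Φ^{pm} V_m + W^p)(∇T)_{p i}`. -/
def LT1 {n : ℕ} (Φ V W : (Fin n → ℝ) → ℝ) (T : Fin n → (Fin n → ℝ) → ℝ)
    (i : Fin n) (x : Fin n → ℝ) : ℝ :=
  (∑ p, ∑ q, ihess Φ x p q * covD2 Φ (covD1 Φ T) p q i x)
    - (1/2) * ∑ p, ((∑ m, ihess Φ x p m * pd V m x) + Wop Φ W p x) * covD1 Φ T p i x

/-- Weighted tensor Laplacian of a (0,2)-tensor. -/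
def LT2 {n : ℕ} (Φ V W : (Fin n → ℝ) → ℝ) (T : Fin n → Fin n → (Fin n → ℝ) → ℝ)
    (i j : Fin n) (x : Fin n → ℝ) : ℝ :=
  (∑ p, ∑ q, ihess Φ x p q * covD3 Φ (covD2 Φ T) p q i j x)
    - (1/2) * ∑ p, ((∑ m, ihess Φ x p m * pd V m x) + Wop Φ W p x) * covD2 Φ T p i j x

/-- Weighted tensor Laplacian of a (0,3)-tensor. -/
def LT3 {n : ℕ} (Φ V W : (Fin n → ℝ) → ℝ) (T : Fin n → Fin n → Fin n → (Fin n → ℝ) → ℝ)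
    (i j k : Fin n) (x : Fin n → ℝ) : ℝ :=
  (∑ p, ∑ q, ihess Φ x p q * covD4 Φ (covD3 Φ T) p q i j k x)
    - (1/2) * ∑ p, ((∑ m, ihess Φ x p m * pd V m x) + Wop Φ W p x) * covD3 Φ T p i j k x

/-- `N_{piab} := Φ_{piab} − ½ Σ_{k,m} Φ^{km}(Φ_{mpi}Φ_{kab} + Φ_{mpa}Φ_{kib} + Φ_{mpb}Φ_{kia})`. -/
def Ncal {n : ℕ} (Φ : (Fin n → ℝ) → ℝ) (p i a b : Fin n) (x : Fin n → ℝ) : ℝ :=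
  pd4 Φ p i a b x - (1/2) * ∑ k, ∑ m, ihess Φ x k m *
    (pd3 Φ m p i x * pd3 Φ k a b x + pd3 Φ m p a x * pd3 Φ k i b x
      + pd3 Φ m p b x * pd3 Φ k i a x)

/-- Riemann curvature `R_{ikjl} := ¼ Σ_{a,m} Φ^{am}(Φ_{ila}Φ_{mkj} − Φ_{ija}Φ_{mkl})`. -/
def Rcal {n : ℕ} (Φ : (Fin n → ℝ) → ℝ) (i k j l : Fin n) (x : Fin n → ℝ) : ℝ :=
  (1/4) * ∑ a, ∑ m, ihess Φ x a m *
    (pd3 Φ i l a x * pd3 Φ m k j x - pd3 Φ i j a x * pd3 Φ m k l x)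

/-- The `h`-norm of a quadratic form `Q` at `x`:
`‖Q‖_h(x) = sup { Σ Q_{ij} v_i v_j : Σ Φ_{ij}(x) v_i v_j = 1 }`. -/
def hnorm {n : ℕ} (Φ : (Fin n → ℝ) → ℝ) (Q : Fin n → Fin n → ℝ) (x : Fin n → ℝ) : ℝ :=
  sSup {r | ∃ v : Fin n → ℝ,
    (∑ i, ∑ j, pd2 Φ i j x * v i * v j) = 1 ∧ r = ∑ i, ∑ j, Q i j * v i * v j}

/-- The matrix `A(x)` with entries `V_{ab} + Ŵ_{ab}`. -/
def Amat {n : ℕ} (Φ V W : (Fin n → ℝ) → ℝ) (x : Fin n → ℝ) : Matrix (Fin n) (Fin n) ℝ :=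
  Matrix.of fun a b => pd2 V a b x + What2 Φ W a b x

/-- The matrix `S_i(x)` with entries `V_{iab} − Ŵ_{iab}`. -/
def Smat {n : ℕ} (Φ V W : (Fin n → ℝ) → ℝ) (i : Fin n) (x : Fin n → ℝ) :
    Matrix (Fin n) (Fin n) ℝ :=
  Matrix.of fun a b => pd3 V i a b x - What3 Φ W i a b x

/-- `H_{ij}(x) := Tr[A(x)⁻¹ · S_i(x) · (D²Φ(x))⁻¹ · S_j(x)]`. -/
def Hten {n : ℕ} (Φ V W : (Fin n → ℝ) → ℝ) (i j : Fin n) (x : Fin n → ℝ) : ℝ :=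
  ((Amat Φ V W x)⁻¹ * Smat Φ V W i x * (hess Φ x)⁻¹ * Smat Φ V W j x).trace

/-- Euclidean operator norm of a matrix. -/
def eOpNorm {n : ℕ} (M : Matrix (Fin n) (Fin n) ℝ) : ℝ :=
  ‖LinearMap.toContinuousLinearMap (Matrix.toEuclideanLin M)‖

/-- Directional derivative of the Hessian: the matrix `∂_e D²F(x)`. -/
def dirHess {n : ℕ} (F : (Fin n → ℝ) → ℝ) (e : Fin n → ℝ) (x : Fin n → ℝ) :
    Matrix (Fin n) (Fin n) ℝ :=
  Matrix.of fun i j => ∑ k, e k * pd3 F k i j x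

/-- The quadratic form `⟨Qy, y⟩`. -/
def qform {n : ℕ} (Q : Matrix (Fin n) (Fin n) ℝ) (y : Fin n → ℝ) : ℝ :=
  ∑ i, ∑ j, Q i j * y j * y i

section Calculus

variable {n : ℕ} {f g : (Fin n → ℝ) → ℝ} {f' g' : ℝ} {p : Fin n} {x : Fin n → ℝ}

/-- `f` is differentiable at `x` with partial derivative `∂_p f` given there by the third argument. -/
def HasPd (f : (Fin n → ℝ) → ℝ) (p : Fin n) (f' : ℝ) (x : Fin n → ℝ) : Prop :=
  DifferentiableAt ℝ f x ∧ pd f p x = f'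

lemma HasPd.congr_deriv (hf : HasPd f p f' x) (h : f' = g') : HasPd f p g' x := h ▸ hf

lemma HasPd.congr_of_eventuallyEq (hf : HasPd f p f' x) (h : g =ᶠ[nhds x] f) :
    HasPd g p f' x :=
  ⟨hf.1.congr_of_eventuallyEq h, by rw [← hf.2, pd, pd, h.fderiv_eq]⟩

lemma HasPd.add (hf : HasPd f p f' x) (hg : HasPd g p g' x) :
    HasPd (fun y => f y + g y) p (f' + g') x :=
  ⟨hf.1.add hg.1, by rw [← hf.2, ← hg.2, pd, fderiv_fun_add hf.1 hg.1]; rfl⟩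

lemma HasPd.sub (hf : HasPd f p f' x) (hg : HasPd g p g' x) :
    HasPd (fun y => f y - g y) p (f' - g') x :=
  ⟨hf.1.sub hg.1, by rw [← hf.2, ← hg.2, pd, fderiv_fun_sub hf.1 hg.1]; rfl⟩

lemma HasPd.mul (hf : HasPd f p f' x) (hg : HasPd g p g' x) :
    HasPd (fun y => f y * g y) p (f' * g x + f x * g') x :=
  ⟨hf.1.mul hg.1, by
    rw [← hf.2, ← hg.2, pd, fderiv_fun_mul hf.1 hg.1]
    simp [pd]; ring⟩

lemma hasPd_const (c : ℝ) : HasPd (fun _ : Fin n → ℝ => c) p 0 x :=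
  ⟨differentiableAt_const c, by simp [pd]⟩

lemma HasPd.const_mul (c : ℝ) (hf : HasPd f p f' x) : HasPd (fun y => c * f y) p (c * f') x :=
  ((hasPd_const c).mul hf).congr_deriv (by ring)

lemma HasPd.sum {ι : Type*} {F : ι → (Fin n → ℝ) → ℝ} {F' : ι → ℝ} (s : Finset ι)
    (h : ∀ k, HasPd (F k) p (F' k) x) :
    HasPd (fun y => ∑ k ∈ s, F k y) p (∑ k ∈ s, F' k) x := by
  classical
  induction s using Finset.induction_on with
  | empty => simpa using hasPd_const (n := n) (p := p) (x := x) 0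
  | insert a s ha ih => simpa [Finset.sum_insert ha] using (h a).add ih

lemma HasPd.prod {ι : Type*} [DecidableEq ι] {F : ι → (Fin n → ℝ) → ℝ} {F' : ι → ℝ}
    (s : Finset ι) (h : ∀ k, HasPd (F k) p (F' k) x) :
    HasPd (fun y => ∏ k ∈ s, F k y) p (∑ k ∈ s, F' k * ∏ j ∈ s.erase k, F j x) x := by
  have hF := HasFDerivAt.finsetProd (u := s) fun k _ => (h k).1.hasFDerivAt
  refine ⟨hF.differentiableAt, ?_⟩
  rw [pd, hF.fderiv]
  simp only [FunLike.coe_sum, Finset.sum_apply, FunLike.coe_smul,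
    Pi.smul_apply, smul_eq_mul]
  exact Finset.sum_congr rfl fun k _ => by rw [← (h k).2, pd, mul_comm]

/-- Entrywise version of `HasPd` for matrix-valued functions. -/
def HasMPd (F : (Fin n → ℝ) → Matrix (Fin n) (Fin n) ℝ) (p : Fin n)
    (F' : Matrix (Fin n) (Fin n) ℝ) (x : Fin n → ℝ) : Prop :=
  ∀ a b, HasPd (fun y => F y a b) p (F' a b) x

variable {F G : (Fin n → ℝ) → Matrix (Fin n) (Fin n) ℝ} {F' G' : Matrix (Fin n) (Fin n) ℝ}

lemma HasMPd.congr_deriv (hF : HasMPd F p F' x) (h : F' = G') : HasMPd F p G' x := h ▸ hF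

lemma HasMPd.congr_of_eventuallyEq (hF : HasMPd F p F' x) (h : G =ᶠ[nhds x] F) :
    HasMPd G p F' x := fun a b =>
  (hF a b).congr_of_eventuallyEq (h.mono fun _ hy => by simp only [hy])

lemma HasMPd.unique (hF : HasMPd F p F' x) (hG : HasMPd F p G' x) : F' = G' := by
  ext a b
  exact (hF a b).2.symm.trans (hG a b).2

lemma HasMPd.add (hF : HasMPd F p F' x) (hG : HasMPd G p G' x) :
    HasMPd (fun y => F y + G y) p (F' + G') x := fun a b => (hF a b).add (hG a b)

lemma HasMPd.sub (hF : HasMPd F p F' x) (hG : HasMPd G p G' x) :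
    HasMPd (fun y => F y - G y) p (F' - G') x := fun a b => (hF a b).sub (hG a b)

lemma hasMPd_const (C : Matrix (Fin n) (Fin n) ℝ) : HasMPd (fun _ => C) p 0 x :=
  fun a b => hasPd_const (C a b)

lemma HasMPd.mul (hF : HasMPd F p F' x) (hG : HasMPd G p G' x) :
    HasMPd (fun y => F y * G y) p (F' * G x + F x * G') x := fun a b => by
  simp only [Matrix.mul_apply, Matrix.add_apply, ← Finset.sum_add_distrib]
  exact HasPd.sum _ fun k => (hF a k).mul (hG k b)

lemma HasPd.smul (hf : HasPd f p f' x) (hG : HasMPd G p G' x) :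
    HasMPd (fun y => f y • G y) p (f' • G x + f x • G') x := fun a b => hf.mul (hG a b)

lemma HasMPd.const_smul (c : ℝ) (hF : HasMPd F p F' x) :
    HasMPd (fun y => c • F y) p (c • F') x := fun a b => (hF a b).const_mul c

lemma HasMPd.sum {ι : Type*} {F : ι → (Fin n → ℝ) → Matrix (Fin n) (Fin n) ℝ}
    {F' : ι → Matrix (Fin n) (Fin n) ℝ} (s : Finset ι) (h : ∀ k, HasMPd (F k) p (F' k) x) :
    HasMPd (fun y => ∑ k ∈ s, F k y) p (∑ k ∈ s, F' k) x := fun a b => by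
  simp only [Matrix.sum_apply]
  exact HasPd.sum _ fun k => h k a b

lemma HasMPd.trace (hF : HasMPd F p F' x) : HasPd (fun y => (F y).trace) p F'.trace x :=
  HasPd.sum _ fun k => hF k k

/-- Jacobi's formula for the derivative of a determinant. -/
lemma HasMPd.det (hF : HasMPd F p F' x) :
    HasPd (fun y => (F y).det) p ((F x).adjugate * F').trace x := by
  simp only [Matrix.det_apply']
  refine (HasPd.sum _ fun σ : Equiv.Perm (Fin n) =>
    (HasPd.prod Finset.univ fun i => hF (σ i) i).const_mul ((Equiv.Perm.sign σ : ℤ) : ℝ)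
    ).congr_deriv ?_
  have key : ∀ i, ((F x).adjugate * F') i i = ((F x).updateCol i fun k => F' k i).det := by
    intro i
    rw [← Matrix.cramer_apply, Matrix.cramer_eq_adjugate_mulVec]
    rfl
  simp only [Matrix.trace, Matrix.diag, key, Matrix.det_apply', Finset.mul_sum]
  rw [Finset.sum_comm]
  refine Finset.sum_congr rfl fun i _ => Finset.sum_congr rfl fun σ _ => ?_
  rw [← Finset.mul_prod_erase Finset.univ _ (Finset.mem_univ i)]
  simp only [Matrix.updateCol_self]
  congr 2
  refine Finset.prod_congr rfl fun j hj => ?_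
  rw [Matrix.updateCol_ne (Finset.ne_of_mem_erase hj)]

lemma HasMPd.inv (hF : HasMPd F p F' x) (hdet : ∀ᶠ y in nhds x, IsUnit (F y).det)
    (hinv : ∀ a b, DifferentiableAt ℝ (fun y => (F y)⁻¹ a b) x) :
    HasMPd (fun y => (F y)⁻¹) p (-((F x)⁻¹ * F' * (F x)⁻¹)) x := by
  have h0 : HasMPd (fun y => (F y)⁻¹) p (Matrix.of fun a b => pd (fun y => (F y)⁻¹ a b) p x) x :=
    fun a b => ⟨hinv a b, rfl⟩
  refine h0.congr_deriv ?_
  set X := Matrix.of fun a b => pd (fun y => (F y)⁻¹ a b) p x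
  have h1 := (h0.mul hF).unique ((hasMPd_const (1 : Matrix (Fin n) (Fin n) ℝ)).congr_of_eventuallyEq
    (hdet.mono fun y hy => Matrix.nonsing_inv_mul _ hy))
  have hx := hdet.self_of_nhds
  have h2 : X * F x * (F x)⁻¹ = -((F x)⁻¹ * F') * (F x)⁻¹ := by
    rw [eq_neg_of_add_eq_zero_left h1]
  rwa [Matrix.mul_assoc, Matrix.mul_nonsing_inv _ hx, Matrix.mul_one, Matrix.neg_mul] at h2

lemma differentiableAt_inv_apply (hF : ∀ a b, DifferentiableAt ℝ (fun y => F y a b) x)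
    (hdet : IsUnit (F x).det) (a b : Fin n) :
    DifferentiableAt ℝ (fun y => (F y)⁻¹ a b) x := by
  have hd : ∀ G : (Fin n → ℝ) → Matrix (Fin n) (Fin n) ℝ,
      (∀ a b, DifferentiableAt ℝ (fun y => G y a b) x) →
      DifferentiableAt ℝ (fun y => (G y).det) x :=
    fun G hG => (HasMPd.det (p := a) (F' := Matrix.of fun c d => pd (fun y => G y c d) a x)
      fun c d => ⟨hG c d, rfl⟩).1
  simp only [Matrix.inv_def, Matrix.smul_apply, smul_eq_mul, Ring.inverse_eq_inv',
    Matrix.adjugate_apply]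
  refine ((hd F hF).inv hdet.ne_zero).mul (hd _ fun c d => ?_)
  by_cases h : c = b
  · subst h; simp
  · simpa [Matrix.updateRow_ne h] using hF c d

end Calculus

section Symmetry

variable {n : ℕ} {Ω : Set (Fin n → ℝ)} {f g : (Fin n → ℝ) → ℝ} {x : Fin n → ℝ}

lemma ContDiffOn.pd (hΩ : IsOpen Ω) (hf : ContDiffOn ℝ (⊤ : ℕ∞) f Ω) (i : Fin n) :
    ContDiffOn ℝ (⊤ : ℕ∞) (_root_.pd f i) Ω :=
  (hf.fderiv_of_isOpen hΩ (by simp)).clm_apply contDiffOn_const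

lemma ContDiffOn.hasPd (hΩ : IsOpen Ω) (hf : ContDiffOn ℝ (⊤ : ℕ∞) f Ω) (hx : x ∈ Ω)
    (i : Fin n) : HasPd f i (_root_.pd f i x) x :=
  ⟨(hf.contDiffAt (hΩ.mem_nhds hx)).differentiableAt (by simp), rfl⟩

lemma pd_congr_of_eqOn (hΩ : IsOpen Ω) (h : Set.EqOn f g Ω) (i : Fin n) :
    Set.EqOn (pd f i) (pd g i) Ω := fun x hx => by
  rw [pd, pd, (h.eventuallyEq_of_mem (hΩ.mem_nhds hx)).fderiv_eq]

lemma pd2_swap (hΩ : IsOpen Ω) (hf : ContDiffOn ℝ (⊤ : ℕ∞) f Ω) (i j : Fin n) :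
    Set.EqOn (pd2 f i j) (pd2 f j i) Ω := fun x hx => by
  have hfx : ContDiffAt ℝ 2 f x := contDiffAt_infty.1 (hf.contDiffAt (hΩ.mem_nhds hx)) 2
  have hsymm : IsSymmSndFDerivAt ℝ f x :=
    hfx.isSymmSndFDerivAt (by simp)
  have hd : DifferentiableAt ℝ (fderiv ℝ f) x :=
    (hfx.fderiv_right (m := 1) (by norm_num)).differentiableAt (by simp)
  have key : ∀ i j : Fin n, pd2 f i j x = fderiv ℝ (fderiv ℝ f) x (Pi.single j 1)
      (Pi.single i 1) := fun i j => by
    have : pd f i = fun y => fderiv ℝ f y (Pi.single i 1) := rfl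
    rw [pd2, pd, this, fderiv_clm_apply hd (differentiableAt_const _)]
    simp
  rw [key, key, hsymm]

lemma pd3_swap_left (hΩ : IsOpen Ω) (hf : ContDiffOn ℝ (⊤ : ℕ∞) f Ω) (i j k : Fin n) :
    Set.EqOn (pd3 f i j k) (pd3 f j i k) Ω :=
  pd_congr_of_eqOn hΩ (pd2_swap hΩ hf i j) k

lemma pd3_swap_right (hΩ : IsOpen Ω) (hf : ContDiffOn ℝ (⊤ : ℕ∞) f Ω) (i j k : Fin n) :
    Set.EqOn (pd3 f i j k) (pd3 f i k j) Ω :=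
  pd2_swap hΩ (hf.pd hΩ i) j k

lemma pd4_swap_left (hΩ : IsOpen Ω) (hf : ContDiffOn ℝ (⊤ : ℕ∞) f Ω) (i j k l : Fin n) :
    Set.EqOn (pd4 f i j k l) (pd4 f j i k l) Ω :=
  pd_congr_of_eqOn hΩ (pd3_swap_left hΩ hf i j k) l

lemma pd4_swap_mid (hΩ : IsOpen Ω) (hf : ContDiffOn ℝ (⊤ : ℕ∞) f Ω) (i j k l : Fin n) :
    Set.EqOn (pd4 f i j k l) (pd4 f i k j l) Ω :=
  pd_congr_of_eqOn hΩ (pd3_swap_right hΩ hf i j k) l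

lemma pd4_swap_right (hΩ : IsOpen Ω) (hf : ContDiffOn ℝ (⊤ : ℕ∞) f Ω) (i j k l : Fin n) :
    Set.EqOn (pd4 f i j k l) (pd4 f i j l k) Ω :=
  pd3_swap_right hΩ (hf.pd hΩ i) j k l

lemma pd4_rotate (hΩ : IsOpen Ω) (hf : ContDiffOn ℝ (⊤ : ℕ∞) f Ω) (i j k l : Fin n) :
    Set.EqOn (pd4 f i j k l) (pd4 f l i j k) Ω := fun x hx => by
  rw [pd4_swap_right hΩ hf i j k l hx, pd4_swap_mid hΩ hf i j l k hx,
    pd4_swap_left hΩ hf i l j k hx]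

lemma pd5_rotate (hΩ : IsOpen Ω) (hf : ContDiffOn ℝ (⊤ : ℕ∞) f Ω) (i j k l m : Fin n) :
    Set.EqOn (pd5 f i j k l m) (pd5 f m i j k l) Ω := fun x hx => by
  have h : pd5 f i j k l m x = pd5 f i m j k l x := pd4_rotate hΩ (hf.pd hΩ i) j k l m hx
  have h' : pd5 f i m j k l x = pd5 f m i j k l x :=
    pd_congr_of_eqOn hΩ (pd4_swap_left hΩ hf i m j k) l hx
  rw [h, h']

lemma pd5_swap_left (hΩ : IsOpen Ω) (hf : ContDiffOn ℝ (⊤ : ℕ∞) f Ω) (i j k l m : Fin n) :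
    Set.EqOn (pd5 f i j k l m) (pd5 f j i k l m) Ω :=
  pd_congr_of_eqOn hΩ (pd4_swap_left hΩ hf i j k l) m

lemma pd5_swap_mid (hΩ : IsOpen Ω) (hf : ContDiffOn ℝ (⊤ : ℕ∞) f Ω) (i j k l m : Fin n) :
    Set.EqOn (pd5 f i j k l m) (pd5 f i k j l m) Ω :=
  pd_congr_of_eqOn hΩ (pd4_swap_mid hΩ hf i j k l) m

end Symmetry

section MatrixFields

variable {n : ℕ}

/-- The matrix `(Φ_{iab})_{ab}`. -/
def thirdMat (Φ : (Fin n → ℝ) → ℝ) (i : Fin n) (x : Fin n → ℝ) : Matrix (Fin n) (Fin n) ℝ :=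
  Matrix.of fun a b => pd3 Φ i a b x

/-- The matrix `(Φ_{piab})_{ab}`. -/
def fourthMat (Φ : (Fin n → ℝ) → ℝ) (p i : Fin n) (x : Fin n → ℝ) :
    Matrix (Fin n) (Fin n) ℝ :=
  Matrix.of fun a b => pd4 Φ p i a b x

/-- The matrix `(Φ_{rpiab})_{ab}`. -/
def fifthMat (Φ : (Fin n → ℝ) → ℝ) (r p i : Fin n) (x : Fin n → ℝ) :
    Matrix (Fin n) (Fin n) ℝ :=
  Matrix.of fun a b => pd5 Φ r p i a b x

/-- The endomorphism `(D²Φ)⁻¹ ∂_i D²Φ`. -/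
def cubicEnd (Φ : (Fin n → ℝ) → ℝ) (i : Fin n) (x : Fin n → ℝ) : Matrix (Fin n) (Fin n) ℝ :=
  ihess Φ x * thirdMat Φ i x

/-- The endomorphism `(D²Φ)⁻¹ ∂_p ∂_i D²Φ`. -/
def quarticEnd (Φ : (Fin n → ℝ) → ℝ) (p i : Fin n) (x : Fin n → ℝ) :
    Matrix (Fin n) (Fin n) ℝ :=
  ihess Φ x * fourthMat Φ p i x

/-- The endomorphism `(D²Φ)⁻¹ ∂_r ∂_p ∂_i D²Φ`. -/
def quinticEnd (Φ : (Fin n → ℝ) → ℝ) (r p i : Fin n) (x : Fin n → ℝ) :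
    Matrix (Fin n) (Fin n) ℝ :=
  ihess Φ x * fifthMat Φ r p i x

/-- The covariant derivative `∇_p` of `cubicEnd Φ i`, as an endomorphism. -/
def covCubicEnd (Φ : (Fin n → ℝ) → ℝ) (p i : Fin n) (x : Fin n → ℝ) :
    Matrix (Fin n) (Fin n) ℝ :=
  quarticEnd Φ p i x
    - (1/2 : ℝ) • (cubicEnd Φ p x * cubicEnd Φ i x + cubicEnd Φ i x * cubicEnd Φ p x)
    - (1/2 : ℝ) • ∑ k, cubicEnd Φ p x k i • cubicEnd Φ k x

/-- A smooth potential on an open set with positive definite Hessian. -/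
structure IsHessianPotential (Ω : Set (Fin n → ℝ)) (Φ : (Fin n → ℝ) → ℝ) : Prop where
  isOpen : IsOpen Ω
  contDiffOn : ContDiffOn ℝ (⊤ : ℕ∞) Φ Ω
  posDef : ∀ x ∈ Ω, (hess Φ x).PosDef

namespace IsHessianPotential

variable {Ω : Set (Fin n → ℝ)} {Φ : (Fin n → ℝ) → ℝ} {x : Fin n → ℝ}

lemma isUnit_det (h : IsHessianPotential Ω Φ) (hx : x ∈ Ω) : IsUnit (hess Φ x).det :=
  (Matrix.isUnit_iff_isUnit_det _).1 (h.posDef x hx).isUnit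

lemma posDef_ihess (h : IsHessianPotential Ω Φ) (hx : x ∈ Ω) : (ihess Φ x).PosDef :=
  (h.posDef x hx).inv

lemma ihess_mul_hess (h : IsHessianPotential Ω Φ) (hx : x ∈ Ω) : ihess Φ x * hess Φ x = 1 :=
  Matrix.nonsing_inv_mul _ (h.isUnit_det hx)

lemma transpose_ihess (h : IsHessianPotential Ω Φ) (hx : x ∈ Ω) :
    (ihess Φ x).transpose = ihess Φ x := by
  simpa using (h.posDef_ihess hx).isHermitian.eq

lemma ihess_symm (h : IsHessianPotential Ω Φ) (hx : x ∈ Ω) (a b : Fin n) :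
    ihess Φ x a b = ihess Φ x b a :=
  congrFun (congrFun (h.transpose_ihess hx) b) a

lemma transpose_thirdMat (h : IsHessianPotential Ω Φ) (hx : x ∈ Ω) (i : Fin n) :
    (thirdMat Φ i x).transpose = thirdMat Φ i x := by
  ext a b
  exact pd3_swap_right h.isOpen h.contDiffOn i b a hx

lemma cubicEnd_symm (h : IsHessianPotential Ω Φ) (hx : x ∈ Ω) (p k i : Fin n) :
    cubicEnd Φ p x k i = cubicEnd Φ i x k p := by
  simp only [cubicEnd, Matrix.mul_apply, thirdMat, Matrix.of_apply]
  refine Finset.sum_congr rfl fun c _ => ?_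
  rw [pd3_swap_left h.isOpen h.contDiffOn p c i hx, pd3_swap_right h.isOpen h.contDiffOn c p i hx,
    pd3_swap_left h.isOpen h.contDiffOn c i p hx]

lemma quarticEnd_comm (h : IsHessianPotential Ω Φ) (hx : x ∈ Ω) (p i : Fin n) :
    quarticEnd Φ p i x = quarticEnd Φ i p x := by
  rw [quarticEnd, quarticEnd]
  congr 1
  ext a b
  exact pd4_swap_left h.isOpen h.contDiffOn p i a b hx

lemma quarticEnd_symm (h : IsHessianPotential Ω Φ) (hx : x ∈ Ω) (p q k i : Fin n) :
    quarticEnd Φ p q x k i = quarticEnd Φ i q x k p := by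
  simp only [quarticEnd, Matrix.mul_apply, fourthMat, Matrix.of_apply]
  refine Finset.sum_congr rfl fun c _ => ?_
  rw [pd4_rotate h.isOpen h.contDiffOn p q c i hx, pd4_swap_mid h.isOpen h.contDiffOn i p q c hx,
    pd4_swap_right h.isOpen h.contDiffOn i q p c hx]

lemma quinticEnd_swap (h : IsHessianPotential Ω Φ) (hx : x ∈ Ω) (p q i : Fin n) :
    quinticEnd Φ p q i x = quinticEnd Φ i q p x := by
  rw [quinticEnd, quinticEnd]
  congr 1
  ext a b
  simp only [fifthMat, Matrix.of_apply]
  rw [pd5_swap_left h.isOpen h.contDiffOn p q i a b hx,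
    pd5_swap_mid h.isOpen h.contDiffOn q p i a b hx,
    pd5_swap_left h.isOpen h.contDiffOn q i p a b hx]

lemma covCubicEnd_comm (h : IsHessianPotential Ω Φ) (hx : x ∈ Ω) (p i : Fin n) :
    covCubicEnd Φ p i x = covCubicEnd Φ i p x := by
  rw [covCubicEnd, covCubicEnd, h.quarticEnd_comm hx p i, add_comm (cubicEnd Φ p x * _)]
  simp only [h.cubicEnd_symm hx p _ i]

lemma cubicEnd_mul_ihess_symm (h : IsHessianPotential Ω Φ) (hx : x ∈ Ω) (i a b : Fin n) :
    (cubicEnd Φ i x * ihess Φ x) a b = (cubicEnd Φ i x * ihess Φ x) b a := by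
  have : (cubicEnd Φ i x * ihess Φ x).transpose = cubicEnd Φ i x * ihess Φ x := by
    rw [cubicEnd, Matrix.transpose_mul, Matrix.transpose_mul, h.transpose_ihess hx,
      h.transpose_thirdMat hx, Matrix.mul_assoc]
  exact congrFun (congrFun this b) a

lemma hasMPd_hess (h : IsHessianPotential Ω Φ) (hx : x ∈ Ω) (p : Fin n) :
    HasMPd (hess Φ) p (thirdMat Φ p x) x := fun a b => by
  refine (((h.contDiffOn.pd h.isOpen a).pd h.isOpen b).hasPd h.isOpen hx p).congr_deriv ?_
  change pd3 Φ a b p x = pd3 Φ p a b x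
  rw [pd3_swap_right h.isOpen h.contDiffOn a b p hx, pd3_swap_left h.isOpen h.contDiffOn a p b hx]

lemma hasMPd_thirdMat (h : IsHessianPotential Ω Φ) (hx : x ∈ Ω) (p i : Fin n) :
    HasMPd (thirdMat Φ i) p (fourthMat Φ p i x) x := fun a b => by
  refine ((((h.contDiffOn.pd h.isOpen i).pd h.isOpen a).pd h.isOpen b).hasPd
    h.isOpen hx p).congr_deriv ?_
  exact pd4_rotate h.isOpen h.contDiffOn i a b p hx

lemma hasMPd_fourthMat (h : IsHessianPotential Ω Φ) (hx : x ∈ Ω) (r p i : Fin n) :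
    HasMPd (fourthMat Φ p i) r (fifthMat Φ r p i x) x := fun a b => by
  refine (((((h.contDiffOn.pd h.isOpen p).pd h.isOpen i).pd h.isOpen a).pd h.isOpen b).hasPd
    h.isOpen hx r).congr_deriv ?_
  exact pd5_rotate h.isOpen h.contDiffOn p i a b r hx

lemma eventually_mem (h : IsHessianPotential Ω Φ) (hx : x ∈ Ω) : ∀ᶠ y in nhds x, y ∈ Ω :=
  h.isOpen.mem_nhds hx

lemma hasMPd_ihess (h : IsHessianPotential Ω Φ) (hx : x ∈ Ω) (p : Fin n) :
    HasMPd (ihess Φ) p (-(cubicEnd Φ p x * ihess Φ x)) x :=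
  (h.hasMPd_hess hx p).inv ((h.eventually_mem hx).mono fun _ hy => h.isUnit_det hy)
    (differentiableAt_inv_apply (fun a b => (h.hasMPd_hess hx p a b).1) (h.isUnit_det hx))

lemma hasMPd_cubicEnd (h : IsHessianPotential Ω Φ) (hx : x ∈ Ω) (p i : Fin n) :
    HasMPd (cubicEnd Φ i) p (quarticEnd Φ p i x - cubicEnd Φ p x * cubicEnd Φ i x) x :=
  ((h.hasMPd_ihess hx p).mul (h.hasMPd_thirdMat hx p i)).congr_deriv (by
    simp only [quarticEnd, cubicEnd]; noncomm_ring)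

lemma hasMPd_quarticEnd (h : IsHessianPotential Ω Φ) (hx : x ∈ Ω) (r p i : Fin n) :
    HasMPd (quarticEnd Φ p i) r (quinticEnd Φ r p i x - cubicEnd Φ r x * quarticEnd Φ p i x) x :=
  ((h.hasMPd_ihess hx r).mul (h.hasMPd_fourthMat hx r p i)).congr_deriv (by
    simp only [quarticEnd, quinticEnd, cubicEnd]; noncomm_ring)

end IsHessianPotential

end MatrixFields

section Commutator

variable {n : ℕ}

/-- The partial derivative `∂_p` of `covCubicEnd Φ q i`. -/
def dCovCubicEnd (Φ : (Fin n → ℝ) → ℝ) (p q i : Fin n) (x : Fin n → ℝ) :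
    Matrix (Fin n) (Fin n) ℝ :=
  (quinticEnd Φ p q i x - cubicEnd Φ p x * quarticEnd Φ q i x)
    - (1/2 : ℝ) • (((quarticEnd Φ p q x - cubicEnd Φ p x * cubicEnd Φ q x) * cubicEnd Φ i x
          + cubicEnd Φ q x * (quarticEnd Φ p i x - cubicEnd Φ p x * cubicEnd Φ i x))
        + ((quarticEnd Φ p i x - cubicEnd Φ p x * cubicEnd Φ i x) * cubicEnd Φ q x
          + cubicEnd Φ i x * (quarticEnd Φ p q x - cubicEnd Φ p x * cubicEnd Φ q x)))
    - (1/2 : ℝ) • ∑ k, ((quarticEnd Φ p q x - cubicEnd Φ p x * cubicEnd Φ q x) k i • cubicEnd Φ k x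
        + cubicEnd Φ q x k i • (quarticEnd Φ p k x - cubicEnd Φ p x * cubicEnd Φ k x))

/-- The second covariant derivative `∇_p ∇_q` of `cubicEnd Φ i`, as an endomorphism. -/
def covCovCubicEnd (Φ : (Fin n → ℝ) → ℝ) (p q i : Fin n) (x : Fin n → ℝ) :
    Matrix (Fin n) (Fin n) ℝ :=
  dCovCubicEnd Φ p q i x
    + (1/2 : ℝ) • (cubicEnd Φ p x * covCubicEnd Φ q i x - covCubicEnd Φ q i x * cubicEnd Φ p x)
    - (1/2 : ℝ) • ∑ k, cubicEnd Φ p x k q • covCubicEnd Φ k i x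
    - (1/2 : ℝ) • ∑ k, cubicEnd Φ p x k i • covCubicEnd Φ q k x

namespace IsHessianPotential

variable {Ω : Set (Fin n → ℝ)} {Φ : (Fin n → ℝ) → ℝ} {x : Fin n → ℝ}

lemma hasMPd_covCubicEnd (h : IsHessianPotential Ω Φ) (hx : x ∈ Ω) (p q i : Fin n) :
    HasMPd (covCubicEnd Φ q i) p (dCovCubicEnd Φ p q i x) x :=
  have hM := h.hasMPd_cubicEnd hx p
  ((h.hasMPd_quarticEnd hx p q i).sub
    ((((hM q).mul (hM i)).add ((hM i).mul (hM q))).const_smul (1/2))).sub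
    ((HasMPd.sum Finset.univ fun k => (hM q k i).smul (hM k)).const_smul (1/2))

lemma mul_cubicEnd_symm (h : IsHessianPotential Ω Φ) (hx : x ∈ Ω)
    (X : Matrix (Fin n) (Fin n) ℝ) (q k i : Fin n) :
    (X * cubicEnd Φ q x) k i = (X * cubicEnd Φ i x) k q := by
  simp only [Matrix.mul_apply, h.cubicEnd_symm hx q _ i]

lemma sum_cubicEnd_smul_sum (h : IsHessianPotential Ω Φ) (hx : x ∈ Ω) (p q i : Fin n) :
    ∑ k, cubicEnd Φ p x k q • ∑ l, cubicEnd Φ k x l i • cubicEnd Φ l x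
      = ∑ l, (cubicEnd Φ i x * cubicEnd Φ p x) l q • cubicEnd Φ l x := by
  simp only [Finset.smul_sum, Matrix.mul_apply, Finset.sum_smul]
  rw [Finset.sum_comm]
  refine Finset.sum_congr rfl fun l _ => Finset.sum_congr rfl fun k _ => ?_
  rw [smul_smul, h.cubicEnd_symm hx k l i, mul_comm]

/-- The Ricci identity for the cubic form. -/
lemma covCovCubicEnd_sub_swap (h : IsHessianPotential Ω Φ) (hx : x ∈ Ω) (p q i : Fin n) :
    covCovCubicEnd Φ p q i x - covCovCubicEnd Φ i q p x
      = -(1/4 : ℝ) • ((cubicEnd Φ p x * cubicEnd Φ i x - cubicEnd Φ i x * cubicEnd Φ p x)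
            * cubicEnd Φ q x
          - cubicEnd Φ q x
            * (cubicEnd Φ p x * cubicEnd Φ i x - cubicEnd Φ i x * cubicEnd Φ p x))
        + (1/4 : ℝ) • ∑ k, (cubicEnd Φ p x * cubicEnd Φ i x - cubicEnd Φ i x * cubicEnd Φ p x) k q
            • cubicEnd Φ k x := by
  have hp := h.sum_cubicEnd_smul_sum hx p q i
  have hi := h.sum_cubicEnd_smul_sum hx i q p
  simp only [covCovCubicEnd, dCovCubicEnd, covCubicEnd, h.quinticEnd_swap hx p q i,
    h.cubicEnd_symm hx q _ i, h.cubicEnd_symm hx q _ p, h.cubicEnd_symm hx p _ i,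
    h.quarticEnd_symm hx i q _ p, Matrix.sub_apply, sub_smul,
    h.mul_cubicEnd_symm hx _ q _ i, h.mul_cubicEnd_symm hx _ q _ p,
    smul_add, smul_sub, Finset.sum_add_distrib, Finset.sum_sub_distrib, mul_add, add_mul, mul_sub,
    sub_mul, Finset.mul_sum, Finset.sum_mul, smul_mul_assoc, mul_smul_comm, mul_assoc,
    smul_comm (cubicEnd Φ _ x _ _) (1/2 : ℝ), ← Finset.smul_sum, hp, hi]
  simp only [h.quarticEnd_comm hx]
  module

end IsHessianPotential

end Commutator

section Divergence

variable {n : ℕ}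

/-- The vector field `-α Φ^{km} Φ_m`. -/
def drift (α : ℝ) (Φ : (Fin n → ℝ) → ℝ) (k : Fin n) (x : Fin n → ℝ) : ℝ :=
  -(α * ∑ m, ihess Φ x k m * pd Φ m x)

namespace IsHessianPotential

variable {Ω : Set (Fin n → ℝ)} {Φ : (Fin n → ℝ) → ℝ} {x : Fin n → ℝ} {α : ℝ}

lemma trace_cubicEnd (h : IsHessianPotential Ω Φ)
    (hKE : ∀ x ∈ Ω, (hess Φ x).det = Real.exp (-(α * Φ x))) (hx : x ∈ Ω) (p : Fin n) :
    (cubicEnd Φ p x).trace = -(α * pd Φ p x) := by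
  have h1 := (h.hasMPd_hess hx p).det
  have h2 : HasPd (fun y => -(α * Φ y)) p (-(α * pd Φ p x)) x :=
    ((h.contDiffOn.hasPd h.isOpen hx p).const_mul (-α)).congr_deriv (by ring)
      |>.congr_of_eventuallyEq (Eventually.of_forall fun y => by ring)
  have h3 : HasPd (fun y => Real.exp (-(α * Φ y))) p
      (Real.exp (-(α * Φ x)) * -(α * pd Φ p x)) x :=
    ⟨h2.1.exp, by rw [pd, fderiv_exp h2.1, ← h2.2]; rfl⟩
  have h4 := h1.2.symm.trans (h3.congr_of_eventuallyEq
    ((h.eventually_mem hx).mono fun y hy => hKE y hy)).2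
  have hadj : (hess Φ x).adjugate = (hess Φ x).det • ihess Φ x := by
    rw [ihess, Matrix.inv_def, smul_smul, Ring.mul_inverse_cancel _ (h.isUnit_det hx), one_smul]
  rw [hadj, Matrix.smul_mul, Matrix.trace_smul, smul_eq_mul, hKE x hx] at h4
  exact mul_left_cancel₀ (Real.exp_pos _).ne' h4

lemma trace_quarticEnd (h : IsHessianPotential Ω Φ)
    (hKE : ∀ x ∈ Ω, (hess Φ x).det = Real.exp (-(α * Φ x))) (hx : x ∈ Ω) (p q : Fin n) :
    (quarticEnd Φ p q x).trace
      = (cubicEnd Φ p x * cubicEnd Φ q x).trace - α * hess Φ x q p := by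
  have h1 := (h.hasMPd_cubicEnd hx p q).trace
  have h2 : HasPd (fun y => (cubicEnd Φ q y).trace) p (-α * pd2 Φ q p x) x :=
    (((h.contDiffOn.pd h.isOpen q).hasPd h.isOpen hx p).const_mul (-α)).congr_of_eventuallyEq
      ((h.eventually_mem hx).mono fun y hy => by
        simp only [h.trace_cubicEnd hKE hy q]; ring)
  have h3 := h1.2.symm.trans h2.2
  rw [Matrix.trace_sub] at h3
  simp only [hess, Matrix.of_apply]
  linarith

lemma cubicEnd_apply (a q c : Fin n) :
    cubicEnd Φ a x q c = ∑ p, ihess Φ x q p * pd3 Φ a p c x := by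
  simp only [cubicEnd, thirdMat, Matrix.mul_apply, Matrix.of_apply]

lemma cubicEnd_mul_apply (X : Matrix (Fin n) (Fin n) ℝ) (p k b : Fin n) :
    (cubicEnd Φ p x * X) k b = ∑ a, ihess Φ x k a * ∑ c, pd3 Φ p a c x * X c b := by
  rw [cubicEnd, Matrix.mul_assoc]
  simp only [thirdMat, Matrix.mul_apply, Matrix.of_apply]

lemma sum_ihess_mul_cubicEnd_mul (h : IsHessianPotential Ω Φ) (hx : x ∈ Ω) (k b : Fin n) :
    ∑ p, ∑ q, ihess Φ x p q * (cubicEnd Φ p x * cubicEnd Φ q x) k b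
      = ∑ a, ihess Φ x k a * (cubicEnd Φ a x * cubicEnd Φ b x).trace := by
  simp only [cubicEnd_mul_apply, Matrix.trace, Matrix.diag, Finset.mul_sum]
  rw [Finset.sum_comm_cycle]
  refine Finset.sum_congr rfl fun a _ => ?_
  rw [Finset.sum_comm]
  refine Finset.sum_congr rfl fun q _ => Finset.sum_congr rfl fun p _ =>
    Finset.sum_congr rfl fun c _ => ?_
  rw [pd3_swap_left h.isOpen h.contDiffOn p a c hx, h.cubicEnd_symm hx q c b,
    h.ihess_symm hx p q]
  ring

lemma sum_ihess_mul_quarticEnd (h : IsHessianPotential Ω Φ) (hx : x ∈ Ω) (k b : Fin n) :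
    ∑ p, ∑ q, ihess Φ x p q * quarticEnd Φ p q x k b
      = ∑ a, ihess Φ x k a * (quarticEnd Φ a b x).trace := by
  simp only [quarticEnd, fourthMat, Matrix.trace, Matrix.diag, Matrix.mul_apply, Matrix.of_apply,
    Finset.mul_sum]
  rw [Finset.sum_comm_cycle]
  refine Finset.sum_congr rfl fun a _ => Finset.sum_congr rfl fun p _ =>
    Finset.sum_congr rfl fun q _ => ?_
  have : pd4 Φ p q a b x = pd4 Φ a b q p x := by
    rw [pd4_rotate h.isOpen h.contDiffOn a b q p hx, pd4_rotate h.isOpen h.contDiffOn p a b q hx,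
      pd4_swap_left h.isOpen h.contDiffOn q p a b hx]
  rw [this]
  ring

lemma sum_ihess_mul_cubicEnd (h : IsHessianPotential Ω Φ)
    (hKE : ∀ x ∈ Ω, (hess Φ x).det = Real.exp (-(α * Φ x))) (hx : x ∈ Ω) (k : Fin n) :
    ∑ p, ∑ q, ihess Φ x p q * cubicEnd Φ p x k q = drift α Φ k x := by
  have h1 : drift α Φ k x = ∑ a, ihess Φ x k a * (cubicEnd Φ a x).trace := by
    simp only [drift, h.trace_cubicEnd hKE hx, Finset.mul_sum, ← Finset.sum_neg_distrib]
    exact Finset.sum_congr rfl fun a _ => by ring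
  rw [h1]
  simp only [cubicEnd_apply, Matrix.trace, Matrix.diag, Finset.mul_sum]
  rw [Finset.sum_comm_cycle]
  refine Finset.sum_congr rfl fun a _ => Finset.sum_congr rfl fun p _ =>
    Finset.sum_congr rfl fun q _ => ?_
  rw [pd3_swap_left h.isOpen h.contDiffOn p a q hx, pd3_swap_right h.isOpen h.contDiffOn a p q hx]
  ring

/-- The divergence of the cubic form. -/
lemma sum_ihess_smul_covCubicEnd (h : IsHessianPotential Ω Φ)
    (hKE : ∀ x ∈ Ω, (hess Φ x).det = Real.exp (-(α * Φ x))) (hx : x ∈ Ω) :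
    ∑ p, ∑ q, ihess Φ x p q • covCubicEnd Φ p q x
      = (-α) • (1 : Matrix (Fin n) (Fin n) ℝ)
        - (1/2 : ℝ) • ∑ k, drift α Φ k x • cubicEnd Φ k x := by
  have hMM : ∑ p, ∑ q, ihess Φ x p q • (cubicEnd Φ q x * cubicEnd Φ p x)
      = ∑ p, ∑ q, ihess Φ x p q • (cubicEnd Φ p x * cubicEnd Φ q x) := by
    rw [Finset.sum_comm]
    simp only [h.ihess_symm hx]
  have hA : ∑ p, ∑ q, ihess Φ x p q • quarticEnd Φ p q x
      = ∑ p, ∑ q, ihess Φ x p q • (cubicEnd Φ p x * cubicEnd Φ q x)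
        + (-α) • (1 : Matrix (Fin n) (Fin n) ℝ) := by
    rw [← h.ihess_mul_hess hx]
    ext k b
    simp only [Matrix.add_apply, Matrix.sum_apply, Matrix.smul_apply, smul_eq_mul,
      h.sum_ihess_mul_quarticEnd hx, h.sum_ihess_mul_cubicEnd_mul hx, h.trace_quarticEnd hKE hx,
      Matrix.mul_apply (M := ihess Φ x), Finset.mul_sum, ← Finset.sum_add_distrib]
    refine Finset.sum_congr rfl fun a _ => ?_
    have : hess Φ x b a = hess Φ x a b := pd2_swap h.isOpen h.contDiffOn b a hx
    rw [this]
    ring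
  have hC : ∑ p, ∑ q, ihess Φ x p q • ∑ k, cubicEnd Φ p x k q • cubicEnd Φ k x
      = ∑ k, drift α Φ k x • cubicEnd Φ k x := by
    simp only [← h.sum_ihess_mul_cubicEnd hKE hx, Finset.sum_smul, Finset.smul_sum, smul_smul]
    rw [Finset.sum_comm_cycle]
  simp only [covCubicEnd, smul_sub, smul_add, Finset.sum_sub_distrib, Finset.sum_add_distrib,
    smul_comm (ihess Φ x _ _) (1/2 : ℝ), ← Finset.smul_sum, hMM, hC, hA]
  module

lemma hasPd_drift (h : IsHessianPotential Ω Φ) (hx : x ∈ Ω) (α : ℝ) (i k : Fin n) :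
    HasPd (drift α Φ k) i
      (-(∑ l, cubicEnd Φ i x k l * drift α Φ l x)
        - α * (1 : Matrix (Fin n) (Fin n) ℝ) k i) x := by
  have h1 : HasPd (fun y => -α * ∑ m, ihess Φ y k m * pd Φ m y) i _ x :=
    (HasPd.sum Finset.univ fun m => (h.hasMPd_ihess hx i k m).mul
      ((h.contDiffOn.pd h.isOpen m).hasPd h.isOpen hx i)).const_mul (-α)
  refine (h1.congr_of_eventuallyEq (Eventually.of_forall fun y => ?_)).congr_deriv ?_
  · simp only [drift]; ring
  · rw [← h.ihess_mul_hess hx, Matrix.mul_apply]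
    have : ∑ l, cubicEnd Φ i x k l * drift α Φ l x
        = -α * ∑ m, (cubicEnd Φ i x * ihess Φ x) k m * pd Φ m x := by
      simp only [drift, Matrix.mul_apply, Finset.mul_sum, Finset.sum_mul,
        ← Finset.sum_neg_distrib]
      rw [Finset.sum_comm]
      exact Finset.sum_congr rfl fun _ _ => Finset.sum_congr rfl fun _ _ => by ring
    rw [this, Finset.sum_add_distrib]
    simp only [Matrix.neg_apply, neg_mul, Finset.sum_neg_distrib, hess, Matrix.of_apply, pd2]
    ring

lemma sum_ihess_smul_sum_left (i : Fin n) (T : Fin n → Fin n → Matrix (Fin n) (Fin n) ℝ) :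
    ∑ p, ∑ q, ihess Φ x p q • ∑ k, cubicEnd Φ i x k p • T k q
      = ∑ p, ∑ q, (cubicEnd Φ i x * ihess Φ x) p q • T p q := by
  simp only [Matrix.mul_apply, Finset.smul_sum, Finset.sum_smul, smul_smul]
  rw [Finset.sum_comm_cycle]
  refine Finset.sum_congr rfl fun k _ => ?_
  rw [Finset.sum_comm]
  simp only [mul_comm]

lemma sum_ihess_smul_sum_right (h : IsHessianPotential Ω Φ) (hx : x ∈ Ω) (i : Fin n)
    (T : Fin n → Fin n → Matrix (Fin n) (Fin n) ℝ) :
    ∑ p, ∑ q, ihess Φ x p q • ∑ k, cubicEnd Φ i x k q • T p k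
      = ∑ p, ∑ q, (cubicEnd Φ i x * ihess Φ x) p q • T p q := by
  refine Finset.sum_congr rfl fun p _ => ?_
  simp only [h.cubicEnd_mul_ihess_symm hx i p, Matrix.mul_apply, Finset.smul_sum, Finset.sum_smul,
    smul_smul]
  rw [Finset.sum_comm]
  refine Finset.sum_congr rfl fun k _ => Finset.sum_congr rfl fun q _ => ?_
  rw [h.ihess_symm hx p q, mul_comm]

/-- The derivative of the divergence of the cubic form. -/
lemma sum_ihess_smul_covCovCubicEnd_left (h : IsHessianPotential Ω Φ)
    (hKE : ∀ x ∈ Ω, (hess Φ x).det = Real.exp (-(α * Φ x))) (hx : x ∈ Ω) (i : Fin n) :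
    ∑ p, ∑ q, ihess Φ x p q • covCovCubicEnd Φ i p q x
      = (α/2) • cubicEnd Φ i x - (1/2 : ℝ) • ∑ k, drift α Φ k x • covCubicEnd Φ i k x
        + (1/4 : ℝ) • ∑ k, (∑ l, cubicEnd Φ i x k l * drift α Φ l x) • cubicEnd Φ k x := by
  have hL : HasMPd (fun y => ∑ p, ∑ q, ihess Φ y p q • covCubicEnd Φ p q y) i _ x :=
    HasMPd.sum Finset.univ fun p => HasMPd.sum Finset.univ fun q =>
      (h.hasMPd_ihess hx i p q).smul (h.hasMPd_covCubicEnd hx i p q)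
  have hR : HasMPd (fun y => (-α) • (1 : Matrix (Fin n) (Fin n) ℝ)
        - (1/2 : ℝ) • ∑ k, drift α Φ k y • cubicEnd Φ k y) i _ x :=
    (hasMPd_const _).sub ((HasMPd.sum Finset.univ fun k =>
      (h.hasPd_drift hx α i k).smul (h.hasMPd_cubicEnd hx i k)).const_smul (1/2))
  have hLR := hL.unique (hR.congr_of_eventuallyEq
    ((h.eventually_mem hx).mono fun y hy => h.sum_ihess_smul_covCubicEnd hKE hy))
  have hD := h.sum_ihess_smul_covCubicEnd hKE hx
  have hleft : ∑ p, ∑ q, ihess Φ x p q • (cubicEnd Φ i x * covCubicEnd Φ p q x)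
      = cubicEnd Φ i x * ∑ p, ∑ q, ihess Φ x p q • covCubicEnd Φ p q x := by
    simp only [Finset.mul_sum, mul_smul_comm]
  have hright : ∑ p, ∑ q, ihess Φ x p q • (covCubicEnd Φ p q x * cubicEnd Φ i x)
      = (∑ p, ∑ q, ihess Φ x p q • covCubicEnd Φ p q x) * cubicEnd Φ i x := by
    simp only [Finset.sum_mul, smul_mul_assoc]
  have hone : ∑ k, (1 : Matrix (Fin n) (Fin n) ℝ) k i • cubicEnd Φ k x = cubicEnd Φ i x := by
    simp [Matrix.one_apply]
  have htwo : ∑ k, drift α Φ k x • ∑ l, cubicEnd Φ i x l k • cubicEnd Φ l x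
      = ∑ k, (∑ l, cubicEnd Φ i x k l * drift α Φ l x) • cubicEnd Φ k x := by
    simp only [Finset.smul_sum, Finset.sum_smul, smul_smul]
    rw [Finset.sum_comm]
    simp only [mul_comm]
  have hcov : ∑ p, ∑ q, ihess Φ x p q • covCovCubicEnd Φ i p q x
      = ∑ p, ∑ q, ihess Φ x p q • dCovCubicEnd Φ i p q x
        + (1/2 : ℝ) • (cubicEnd Φ i x * ∑ p, ∑ q, ihess Φ x p q • covCubicEnd Φ p q x
          - (∑ p, ∑ q, ihess Φ x p q • covCubicEnd Φ p q x) * cubicEnd Φ i x)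
        - ∑ p, ∑ q, (cubicEnd Φ i x * ihess Φ x) p q • covCubicEnd Φ p q x := by
    simp only [covCovCubicEnd, smul_sub, smul_add, Finset.sum_sub_distrib,
      Finset.sum_add_distrib, smul_comm (ihess Φ x _ _) (1/2 : ℝ), ← Finset.smul_sum,
      sum_ihess_smul_sum_left, h.sum_ihess_smul_sum_right hx, hleft, hright]
    module
  simp only [Matrix.neg_apply, neg_smul, Finset.sum_add_distrib, Finset.sum_neg_distrib] at hLR
  rw [hcov, hD, eq_add_of_neg_add_eq hLR]
  simp only [covCubicEnd, sub_smul, neg_smul, smul_sub, smul_add, Finset.sum_sub_distrib,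
    Finset.sum_add_distrib, Finset.sum_neg_distrib, ← smul_smul, ← Finset.smul_sum, hone,
    smul_comm (drift _ _ _ _) (1/2 : ℝ), htwo, mul_sub, sub_mul, mul_smul_comm,
    smul_mul_assoc, Finset.mul_sum, Finset.sum_mul, mul_one, one_mul, mul_neg, neg_mul]
  module

/-- The weighted rough Laplacian of the cubic form. -/
lemma sum_ihess_smul_covCovCubicEnd (h : IsHessianPotential Ω Φ)
    (hKE : ∀ x ∈ Ω, (hess Φ x).det = Real.exp (-(α * Φ x))) (hx : x ∈ Ω) (i : Fin n) :
    ∑ p, ∑ q, ihess Φ x p q • covCovCubicEnd Φ p q i x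
      = (α/2) • cubicEnd Φ i x - (1/2 : ℝ) • ∑ k, drift α Φ k x • covCubicEnd Φ k i x
        + (1/4 : ℝ) • ∑ k, (∑ a, ihess Φ x k a * (cubicEnd Φ a x * cubicEnd Φ i x).trace)
            • cubicEnd Φ k x
        - (1/4 : ℝ) • ∑ p, ∑ q, ihess Φ x p q •
          ((cubicEnd Φ p x * cubicEnd Φ i x - cubicEnd Φ i x * cubicEnd Φ p x) * cubicEnd Φ q x
          - cubicEnd Φ q x
            * (cubicEnd Φ p x * cubicEnd Φ i x - cubicEnd Φ i x * cubicEnd Φ p x)) := by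
  have hswap : ∑ p, ∑ q, ihess Φ x p q • covCovCubicEnd Φ i q p x
      = ∑ p, ∑ q, ihess Φ x p q • covCovCubicEnd Φ i p q x := by
    rw [Finset.sum_comm]
    simp only [h.ihess_symm hx]
  have hK : ∑ p, ∑ q, ihess Φ x p q • ∑ k, (cubicEnd Φ p x * cubicEnd Φ i x) k q • cubicEnd Φ k x
      = ∑ k, (∑ a, ihess Φ x k a * (cubicEnd Φ a x * cubicEnd Φ i x).trace)
            • cubicEnd Φ k x := by
    simp only [← h.sum_ihess_mul_cubicEnd_mul hx, h.mul_cubicEnd_symm hx _ i, Finset.smul_sum,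
      Finset.sum_smul, smul_smul]
    rw [Finset.sum_comm_cycle]
  have hdr : ∑ p, ∑ q, ihess Φ x p q • ∑ k, (cubicEnd Φ i x * cubicEnd Φ p x) k q • cubicEnd Φ k x
      = ∑ k, (∑ l, cubicEnd Φ i x k l * drift α Φ l x) • cubicEnd Φ k x := by
    simp only [← h.sum_ihess_mul_cubicEnd hKE hx, Finset.smul_sum, smul_smul]
    rw [Finset.sum_comm_cycle]
    refine Finset.sum_congr rfl fun k _ => ?_
    simp only [← Finset.sum_smul, Matrix.mul_apply, Finset.mul_sum]
    congr 1
    rw [Finset.sum_comm_cycle]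
    exact Finset.sum_congr rfl fun _ _ => Finset.sum_congr rfl fun _ _ =>
      Finset.sum_congr rfl fun _ _ => by ring
  have hcurv : ∀ p q, covCovCubicEnd Φ p q i x = _ := fun p q =>
    eq_add_of_sub_eq' (h.covCovCubicEnd_sub_swap hx p q i)
  simp only [hcurv, smul_add, Finset.sum_add_distrib, hswap,
    h.sum_ihess_smul_covCovCubicEnd_left hKE hx, smul_comm (ihess Φ x _ _) (-(1/4) : ℝ),
    smul_comm (ihess Φ x _ _) (1/4 : ℝ), ← Finset.smul_sum, Matrix.sub_apply, sub_smul,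
    Finset.sum_sub_distrib, smul_sub, hK, hdr, h.covCubicEnd_comm hx i]
  module

end IsHessianPotential

end Divergence

section Assembly

variable {n : ℕ}

lemma sum_mul_mul_eq_trace {K : Matrix (Fin n) (Fin n) ℝ} (hK : K.transpose = K)
    (X Y : Matrix (Fin n) (Fin n) ℝ) :
    ∑ a, ∑ b, ∑ c, ∑ d, X a b * Y c d * K a c * K b d = (K * X * (K * Y.transpose)).trace := by
  have hK' : ∀ a b, K a b = K b a := fun a b => congrFun (congrFun hK b) a
  simp only [Matrix.trace, Matrix.diag, Matrix.mul_apply, Finset.sum_mul, Finset.mul_sum,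
    Matrix.transpose_apply]
  rw [Finset.sum_comm_cycle]
  refine Finset.sum_congr rfl fun c _ => ?_
  rw [Finset.sum_comm]
  refine Finset.sum_congr rfl fun b _ => ?_
  rw [Finset.sum_comm]
  refine Finset.sum_congr rfl fun d _ => Finset.sum_congr rfl fun a _ => ?_
  rw [hK' c a]
  ring

/-- The matrix `(N_{piab})_{ab}`. -/
def nMat (Φ : (Fin n → ℝ) → ℝ) (p i : Fin n) (x : Fin n → ℝ) : Matrix (Fin n) (Fin n) ℝ :=
  Matrix.of fun a b => Ncal Φ p i a b x

/-- The matrix `(R_{iabc})_{bc}`. -/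
def rMat (Φ : (Fin n → ℝ) → ℝ) (i a : Fin n) (x : Fin n → ℝ) : Matrix (Fin n) (Fin n) ℝ :=
  Matrix.of fun b c => Rcal Φ i a b c x

namespace IsHessianPotential

variable {Ω : Set (Fin n → ℝ)} {Φ : (Fin n → ℝ) → ℝ} {x : Fin n → ℝ} {α : ℝ}

lemma calabi_eq_trace (h : IsHessianPotential Ω Φ) (hx : x ∈ Ω) (i j : Fin n) :
    calabi Φ i j x = (cubicEnd Φ i x * cubicEnd Φ j x).trace := by
  have := sum_mul_mul_eq_trace (h.transpose_ihess hx) (thirdMat Φ i x) (thirdMat Φ j x)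
  rw [h.transpose_thirdMat hx] at this
  exact this

lemma Γh_eq (h : IsHessianPotential Ω Φ) (hx : x ∈ Ω) (k p q : Fin n) :
    Γh Φ k p q x = (1/2) * cubicEnd Φ p x k q := by
  rw [Γh, cubicEnd_apply]
  simp only [pd3_swap_left h.isOpen h.contDiffOn p _ q hx]

lemma covD2_calabi (h : IsHessianPotential Ω Φ) (hx : x ∈ Ω) (p i j : Fin n) :
    covD2 Φ (calabi Φ) p i j x
      = (covCubicEnd Φ p i x * cubicEnd Φ j x + cubicEnd Φ i x * covCubicEnd Φ p j x).trace := by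
  have hd := (((h.hasMPd_cubicEnd hx p i).mul (h.hasMPd_cubicEnd hx p j)).trace
    |>.congr_of_eventuallyEq ((h.eventually_mem hx).mono fun y hy => h.calabi_eq_trace hy i j)).2
  have c1 := Matrix.trace_mul_comm (cubicEnd Φ p x) (cubicEnd Φ i x * cubicEnd Φ j x)
  rw [covD2, hd]
  simp only [h.Γh_eq hx, h.calabi_eq_trace hx, covCubicEnd, sub_mul, mul_sub, add_mul, mul_add,
    smul_mul_assoc, mul_smul_comm, Finset.mul_sum, Finset.sum_mul, Matrix.trace_add,
    Matrix.trace_sub, Matrix.trace_smul, Matrix.trace_sum, smul_eq_mul, mul_assoc] at c1 ⊢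
  simp only [← Finset.mul_sum]
  linarith

lemma covD3_covD2_calabi (h : IsHessianPotential Ω Φ) (hx : x ∈ Ω) (p q i j : Fin n) :
    covD3 Φ (covD2 Φ (calabi Φ)) p q i j x
      = (covCovCubicEnd Φ p q i x * cubicEnd Φ j x).trace
        + (covCubicEnd Φ q i x * covCubicEnd Φ p j x).trace
        + (covCubicEnd Φ p i x * covCubicEnd Φ q j x).trace
        + (cubicEnd Φ i x * covCovCubicEnd Φ p q j x).trace := by
  have hT := fun j => h.hasMPd_covCubicEnd hx p q j
  have hM := fun j => h.hasMPd_cubicEnd hx p j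
  have hd := ((((hT i).mul (hM j)).add ((hM i).mul (hT j))).trace
    |>.congr_of_eventuallyEq ((h.eventually_mem hx).mono fun y hy => h.covD2_calabi hy q i j)).2
  have hcov : ∀ i, covCubicEnd Φ p i x
      = (quarticEnd Φ p i x - cubicEnd Φ p x * cubicEnd Φ i x)
        + (1/2 : ℝ) • (cubicEnd Φ p x * cubicEnd Φ i x - cubicEnd Φ i x * cubicEnd Φ p x)
        - (1/2 : ℝ) • ∑ k, cubicEnd Φ p x k i • cubicEnd Φ k x := fun i => by
    rw [covCubicEnd]; module
  have c1 := Matrix.trace_mul_comm (cubicEnd Φ p x) (covCubicEnd Φ q i x * cubicEnd Φ j x)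
  have c2 := Matrix.trace_mul_comm (cubicEnd Φ p x) (cubicEnd Φ i x * covCubicEnd Φ q j x)
  rw [covD3, hd, hcov i, hcov j]
  simp only [h.Γh_eq hx, h.covD2_calabi hx, covCovCubicEnd, sub_mul, mul_sub, add_mul, mul_add,
    smul_mul_assoc, mul_smul_comm, Finset.mul_sum, Finset.sum_mul, Matrix.trace_add,
    Matrix.trace_sub, Matrix.trace_smul, Matrix.trace_sum, smul_eq_mul, mul_assoc,
    Finset.sum_add_distrib] at c1 c2 ⊢
  simp only [← Finset.mul_sum]
  linarith

lemma LT2_calabi (h : IsHessianPotential Ω Φ)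
    (hKE : ∀ x ∈ Ω, (hess Φ x).det = Real.exp (-(α * Φ x))) (hx : x ∈ Ω) (i j : Fin n) :
    LT2 Φ (fun y => α * Φ y) (fun _ => 0) (calabi Φ) i j x
      = α * calabi Φ i j x
        + (1/4) * ∑ k, (∑ a, ihess Φ x k a * calabi Φ a i x) * calabi Φ k j x
        + (1/4) * ∑ k, (∑ a, ihess Φ x k a * calabi Φ a j x) * calabi Φ k i x
        + 2 * ∑ p, ∑ q, ihess Φ x p q * (covCubicEnd Φ p i x * covCubicEnd Φ q j x).trace
        - (1/2) * ∑ p, ∑ q, ihess Φ x p q *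
          ((cubicEnd Φ p x * cubicEnd Φ i x - cubicEnd Φ i x * cubicEnd Φ p x)
            * (cubicEnd Φ q x * cubicEnd Φ j x - cubicEnd Φ j x * cubicEnd Φ q x)).trace := by
  have hdrift : ∀ p, (∑ m, ihess Φ x p m * pd (fun y => α * Φ y) m x) + Wop Φ (fun _ => 0) p x
      = -drift α Φ p x := fun p => by
    have hW : Wop Φ (fun _ => 0) p x = 0 := (hasPd_const 0).2
    simp only [((h.contDiffOn.hasPd h.isOpen hx _).const_mul α).2, hW, drift, Finset.mul_sum,
      add_zero, neg_neg]
    exact Finset.sum_congr rfl fun m _ => by ring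
  have hTT : ∑ p, ∑ q, ihess Φ x p q * (covCubicEnd Φ q i x * covCubicEnd Φ p j x).trace
      = ∑ p, ∑ q, ihess Φ x p q * (covCubicEnd Φ p i x * covCubicEnd Φ q j x).trace := by
    rw [Finset.sum_comm]
    simp only [h.ihess_symm hx]
  have hi : ∑ p, ∑ q, ihess Φ x p q * (covCovCubicEnd Φ p q i x * cubicEnd Φ j x).trace
      = ((∑ p, ∑ q, ihess Φ x p q • covCovCubicEnd Φ p q i x) * cubicEnd Φ j x).trace := by
    simp only [Finset.sum_mul, smul_mul_assoc, Matrix.trace_sum, Matrix.trace_smul, smul_eq_mul]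
  have hj : ∑ p, ∑ q, ihess Φ x p q * (cubicEnd Φ i x * covCovCubicEnd Φ p q j x).trace
      = ((∑ p, ∑ q, ihess Φ x p q • covCovCubicEnd Φ p q j x) * cubicEnd Φ i x).trace := by
    simp only [Finset.sum_mul, smul_mul_assoc, Matrix.trace_sum, Matrix.trace_smul, smul_eq_mul,
      Matrix.trace_mul_comm (cubicEnd Φ i x)]
  have hbr : ∀ X C D : Matrix (Fin n) (Fin n) ℝ,
      ((X * C - C * X) * D).trace = (X * (C * D - D * C)).trace := fun X C D => by
    rw [sub_mul, mul_sub, Matrix.trace_sub, Matrix.trace_sub, mul_assoc C,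
      Matrix.trace_mul_comm C, mul_assoc, mul_assoc]
  have hlap : ∀ i j, ((∑ p, ∑ q, ihess Φ x p q • covCovCubicEnd Φ p q i x) * cubicEnd Φ j x).trace
      = α/2 * (cubicEnd Φ i x * cubicEnd Φ j x).trace
        - 1/2 * ∑ p, drift α Φ p x * (covCubicEnd Φ p i x * cubicEnd Φ j x).trace
        + 1/4 * ∑ k, (∑ a, ihess Φ x k a * (cubicEnd Φ a x * cubicEnd Φ i x).trace)
            * (cubicEnd Φ k x * cubicEnd Φ j x).trace
        - 1/4 * ∑ p, ∑ q, ihess Φ x p q *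
          ((cubicEnd Φ p x * cubicEnd Φ i x - cubicEnd Φ i x * cubicEnd Φ p x)
            * (cubicEnd Φ q x * cubicEnd Φ j x - cubicEnd Φ j x * cubicEnd Φ q x)).trace :=
    fun i j => by
    simp only [← hbr]
    rw [h.sum_ihess_smul_covCovCubicEnd hKE hx, sub_mul, add_mul, sub_mul]
    simp only [smul_mul_assoc, Finset.sum_mul, Matrix.trace_add,
      Matrix.trace_sub, Matrix.trace_smul, Matrix.trace_sum, smul_eq_mul]
  have hsymm : ∑ p, ∑ q, ihess Φ x p q *
          ((cubicEnd Φ p x * cubicEnd Φ j x - cubicEnd Φ j x * cubicEnd Φ p x)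
            * (cubicEnd Φ q x * cubicEnd Φ i x - cubicEnd Φ i x * cubicEnd Φ q x)).trace
      = ∑ p, ∑ q, ihess Φ x p q *
          ((cubicEnd Φ p x * cubicEnd Φ i x - cubicEnd Φ i x * cubicEnd Φ p x)
            * (cubicEnd Φ q x * cubicEnd Φ j x - cubicEnd Φ j x * cubicEnd Φ q x)).trace := by
    rw [Finset.sum_comm]
    refine Finset.sum_congr rfl fun p _ => Finset.sum_congr rfl fun q _ => ?_
    rw [h.ihess_symm hx, Matrix.trace_mul_comm]
  have hdr : ∑ p, drift α Φ p x * (cubicEnd Φ i x * covCubicEnd Φ p j x).trace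
      = ∑ p, drift α Φ p x * (covCubicEnd Φ p j x * cubicEnd Φ i x).trace := by
    simp only [Matrix.trace_mul_comm (cubicEnd Φ i x)]
  have hc := Matrix.trace_mul_comm (cubicEnd Φ i x) (cubicEnd Φ j x)
  simp only [LT2, hdrift, h.covD3_covD2_calabi hx, h.covD2_calabi hx, mul_add,
    Finset.sum_add_distrib, hTT, hi, hj, hlap, Matrix.trace_add, h.calabi_eq_trace hx,
    neg_mul, Finset.sum_neg_distrib, hdr, hsymm, hc]
  ring

lemma ihess_mul_nMat (h : IsHessianPotential Ω Φ) (hx : x ∈ Ω) (p i : Fin n) :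
    ihess Φ x * nMat Φ p i x = covCubicEnd Φ p i x := by
  have : nMat Φ p i x = fourthMat Φ p i x
      - (1/2 : ℝ) • (thirdMat Φ p x * ihess Φ x * thirdMat Φ i x
        + thirdMat Φ i x * ihess Φ x * thirdMat Φ p x)
      - (1/2 : ℝ) • ∑ k, cubicEnd Φ p x k i • thirdMat Φ k x := by
    ext a b
    simp only [nMat, Ncal, fourthMat, thirdMat, cubicEnd_apply, Matrix.of_apply, Matrix.sub_apply,
      Matrix.smul_apply, Matrix.add_apply, Matrix.sum_apply, Matrix.mul_apply, smul_eq_mul,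
      Finset.sum_mul, mul_add, Finset.sum_add_distrib]
    have h1 : ∑ k, ∑ m, ihess Φ x k m * (pd3 Φ m p i x * pd3 Φ k a b x)
        = ∑ k, ∑ m, ihess Φ x k m * pd3 Φ p m i x * pd3 Φ k a b x :=
      Finset.sum_congr rfl fun k _ => Finset.sum_congr rfl fun m _ => by
        rw [pd3_swap_left h.isOpen h.contDiffOn m p i hx, mul_assoc]
    have h2 : ∑ k, ∑ m, ihess Φ x k m * (pd3 Φ m p a x * pd3 Φ k i b x)
        = ∑ k, ∑ m, pd3 Φ p a m x * ihess Φ x m k * pd3 Φ i k b x :=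
      Finset.sum_congr rfl fun k _ => Finset.sum_congr rfl fun m _ => by
        rw [pd3_swap_left h.isOpen h.contDiffOn m p a hx,
          pd3_swap_right h.isOpen h.contDiffOn p m a hx,
          pd3_swap_left h.isOpen h.contDiffOn k i b hx, h.ihess_symm hx k m]
        ring
    have h3 : ∑ k, ∑ m, ihess Φ x k m * (pd3 Φ m p b x * pd3 Φ k i a x)
        = ∑ k, ∑ m, pd3 Φ i a m x * ihess Φ x m k * pd3 Φ p k b x := by
      rw [Finset.sum_comm]
      refine Finset.sum_congr rfl fun k _ => Finset.sum_congr rfl fun m _ => ?_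
      rw [pd3_swap_left h.isOpen h.contDiffOn k p b hx,
        pd3_swap_left h.isOpen h.contDiffOn m i a hx,
        pd3_swap_right h.isOpen h.contDiffOn i m a hx]
      ring
    rw [h1, h2, h3]
    ring
  rw [this, covCubicEnd]
  simp only [mul_sub, mul_smul_comm, mul_add, Finset.mul_sum, quarticEnd, cubicEnd, mul_assoc]

lemma transpose_nMat (h : IsHessianPotential Ω Φ) (hx : x ∈ Ω) (p i : Fin n) :
    (nMat Φ p i x).transpose = nMat Φ p i x := by
  ext a b
  simp only [nMat, Ncal, Matrix.transpose_apply, Matrix.of_apply]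
  rw [pd4_swap_right h.isOpen h.contDiffOn p i b a hx]
  congr 2
  refine Finset.sum_congr rfl fun k _ => Finset.sum_congr rfl fun m _ => ?_
  rw [pd3_swap_right h.isOpen h.contDiffOn k b a hx]
  ring

lemma ihess_mul_rMat (h : IsHessianPotential Ω Φ) (hx : x ∈ Ω) (i k : Fin n) :
    ihess Φ x * rMat Φ i k x
      = (1/4 : ℝ) • (cubicEnd Φ k x * cubicEnd Φ i x - cubicEnd Φ i x * cubicEnd Φ k x) := by
  have : rMat Φ i k x = (1/4 : ℝ) • (thirdMat Φ k x * ihess Φ x * thirdMat Φ i x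
      - thirdMat Φ i x * ihess Φ x * thirdMat Φ k x) := by
    ext j l
    simp only [rMat, Rcal, thirdMat, Matrix.of_apply, Matrix.smul_apply, Matrix.sub_apply,
      Matrix.mul_apply, smul_eq_mul, Finset.sum_mul, mul_sub, Finset.sum_sub_distrib]
    have h1 : ∑ a, ∑ m, ihess Φ x a m * (pd3 Φ i l a x * pd3 Φ m k j x)
        = ∑ a, ∑ m, pd3 Φ k j m x * ihess Φ x m a * pd3 Φ i a l x :=
      Finset.sum_congr rfl fun a _ => Finset.sum_congr rfl fun m _ => by
        rw [pd3_swap_left h.isOpen h.contDiffOn m k j hx,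
          pd3_swap_right h.isOpen h.contDiffOn k m j hx,
          pd3_swap_right h.isOpen h.contDiffOn i l a hx, h.ihess_symm hx a m]
        ring
    have h2 : ∑ a, ∑ m, ihess Φ x a m * (pd3 Φ i j a x * pd3 Φ m k l x)
        = ∑ a, ∑ m, pd3 Φ i j m x * ihess Φ x m a * pd3 Φ k a l x := by
      rw [Finset.sum_comm]
      refine Finset.sum_congr rfl fun a _ => Finset.sum_congr rfl fun m _ => ?_
      rw [pd3_swap_left h.isOpen h.contDiffOn a k l hx]
      ring
    rw [h1, h2]
  rw [this]
  simp only [cubicEnd, mul_smul_comm, mul_sub, mul_assoc]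

lemma transpose_rMat (i k : Fin n) : (rMat Φ i k x).transpose = -rMat Φ i k x := by
  ext j l
  simp only [rMat, Rcal, Matrix.transpose_apply, Matrix.neg_apply, Matrix.of_apply, ← mul_neg,
    ← Finset.sum_neg_distrib]
  congr 1
  exact Finset.sum_congr rfl fun _ _ => Finset.sum_congr rfl fun _ _ => by ring

lemma sum_Ncal_mul_Ncal (h : IsHessianPotential Ω Φ) (hx : x ∈ Ω) (i j : Fin n) :
    ∑ p, ∑ q, ∑ a, ∑ b, ∑ c, ∑ d, Ncal Φ p i a b x * Ncal Φ q j c d x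
              * ihess Φ x p q * ihess Φ x a c * ihess Φ x b d
      = ∑ p, ∑ q, ihess Φ x p q * (covCubicEnd Φ p i x * covCubicEnd Φ q j x).trace := by
  refine Finset.sum_congr rfl fun p _ => Finset.sum_congr rfl fun q _ => ?_
  have := sum_mul_mul_eq_trace (h.transpose_ihess hx) (nMat Φ p i x) (nMat Φ q j x)
  rw [h.transpose_nMat hx, h.ihess_mul_nMat hx, h.ihess_mul_nMat hx] at this
  rw [← this]
  simp only [Finset.mul_sum, nMat, Matrix.of_apply]
  refine Finset.sum_congr rfl fun a _ => Finset.sum_congr rfl fun b _ =>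
    Finset.sum_congr rfl fun c _ => Finset.sum_congr rfl fun d _ => ?_
  ring

lemma sum_Rcal_mul_Rcal (h : IsHessianPotential Ω Φ) (hx : x ∈ Ω) (i j : Fin n) :
    ∑ a, ∑ b, ∑ c, ∑ p, ∑ q, ∑ r, Rcal Φ i a b c x * Rcal Φ j p q r x
              * ihess Φ x a p * ihess Φ x b q * ihess Φ x c r
      = -(1/16) * ∑ p, ∑ q, ihess Φ x p q *
          ((cubicEnd Φ p x * cubicEnd Φ i x - cubicEnd Φ i x * cubicEnd Φ p x)
            * (cubicEnd Φ q x * cubicEnd Φ j x - cubicEnd Φ j x * cubicEnd Φ q x)).trace := by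
  rw [Finset.mul_sum]
  refine Finset.sum_congr rfl fun p _ => ?_
  rw [Finset.sum_comm_cycle, Finset.mul_sum]
  refine Finset.sum_congr rfl fun q _ => ?_
  have := sum_mul_mul_eq_trace (h.transpose_ihess hx) (rMat Φ i p x) (rMat Φ j q x)
  rw [transpose_rMat, mul_neg, mul_neg, h.ihess_mul_rMat hx, h.ihess_mul_rMat hx, smul_mul_smul,
    Matrix.trace_neg, Matrix.trace_smul, smul_eq_mul] at this
  rw [show ∀ t : ℝ, -(1/16) * (ihess Φ x p q * t) = ihess Φ x p q * -(1/4 * (1/4) * t) by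
    intro t; ring, ← this]
  simp only [Finset.mul_sum, rMat, Matrix.of_apply]
  refine Finset.sum_congr rfl fun a _ => Finset.sum_congr rfl fun b _ =>
    Finset.sum_congr rfl fun c _ => Finset.sum_congr rfl fun d _ => ?_
  ring

end IsHessianPotential

end Assembly

section Positivity

variable {n : ℕ}

open scoped Kronecker in
lemma sum_mul_mul_kronecker_nonneg {K : Matrix (Fin n) (Fin n) ℝ} (hK : K.PosSemidef)
    (u : Fin n → Fin n → Fin n → ℝ) :
    0 ≤ ∑ a, ∑ b, ∑ c, ∑ p, ∑ q, ∑ r, u a b c * u p q r * K a p * K b q * K c r := by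
  have h := (hK.kronecker (hK.kronecker hK)).dotProduct_mulVec_nonneg
    (fun s : Fin n × Fin n × Fin n => u s.1 s.2.1 s.2.2)
  simp only [dotProduct, Matrix.mulVec, Fintype.sum_prod_type, Matrix.kronecker_apply,
    Pi.star_apply, star_trivial, Finset.mul_sum] at h
  refine h.trans_eq ?_
  refine Finset.sum_congr rfl fun a _ => Finset.sum_congr rfl fun b _ =>
    Finset.sum_congr rfl fun c _ => Finset.sum_congr rfl fun p _ => Finset.sum_congr rfl fun q _ =>
    Finset.sum_congr rfl fun r _ => ?_
  ring

/-- The Gram matrix of `n` cubic tensors with respect to a positive semidefinite form is positive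
semidefinite. -/
lemma sum_gram_nonneg {K : Matrix (Fin n) (Fin n) ℝ} (hK : K.PosSemidef)
    (B : Fin n → Fin n → Fin n → Fin n → ℝ) (v : Fin n → ℝ) :
    0 ≤ ∑ i, ∑ j, (∑ a, ∑ b, ∑ c, ∑ p, ∑ q, ∑ r,
      B i a b c * B j p q r * K a p * K b q * K c r) * v i * v j := by
  refine (sum_mul_mul_kronecker_nonneg hK fun a b c => ∑ i, B i a b c * v i).trans_eq ?_
  have key : ∀ F : Fin n × Fin n → Fin n × Fin n × Fin n × Fin n × Fin n × Fin n → ℝ,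
      ∑ s, ∑ t, F t s = ∑ t, ∑ s, F t s := fun F => Finset.sum_comm
  have := key fun t s => B t.1 s.1 s.2.1 s.2.2.1 * B t.2 s.2.2.2.1 s.2.2.2.2.1 s.2.2.2.2.2
    * K s.1 s.2.2.2.1 * K s.2.1 s.2.2.2.2.1 * K s.2.2.1 s.2.2.2.2.2 * v t.1 * v t.2
  simp only [Fintype.sum_prod_type] at this
  simp only [Finset.sum_mul]
  rw [← this]
  refine Finset.sum_congr rfl fun a _ => Finset.sum_congr rfl fun b _ =>
    Finset.sum_congr rfl fun c _ => Finset.sum_congr rfl fun p _ => Finset.sum_congr rfl fun q _ =>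
    Finset.sum_congr rfl fun r _ => Finset.sum_congr rfl fun i _ => ?_
  simp only [Finset.mul_sum, Finset.sum_mul]
  exact Finset.sum_congr rfl fun j _ => by ring

lemma sum_comm_middle (F : Fin n → Fin n → Fin n → Fin n → Fin n → Fin n → ℝ) :
    ∑ p, ∑ q, ∑ a, ∑ b, ∑ c, ∑ d, F p q a b c d = ∑ p, ∑ a, ∑ b, ∑ q, ∑ c, ∑ d, F p q a b c d :=
  Finset.sum_congr rfl fun _ _ => Finset.sum_comm_cycle.symm

namespace IsHessianPotential

variable {Ω : Set (Fin n → ℝ)} {Φ : (Fin n → ℝ) → ℝ} {x : Fin n → ℝ} {α : ℝ}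

lemma calabi_comm (h : IsHessianPotential Ω Φ) (hx : x ∈ Ω) (i j : Fin n) :
    calabi Φ i j x = calabi Φ j i x := by
  rw [h.calabi_eq_trace hx, h.calabi_eq_trace hx, Matrix.trace_mul_comm]

lemma sum_calabi_mul_ihess_mul_pd2 (h : IsHessianPotential Ω Φ) (hx : x ∈ Ω) (i j : Fin n) :
    ∑ k, ∑ m, calabi Φ k i x * ihess Φ x k m * pd2 Φ m j x = calabi Φ j i x := by
  have hδ : ∀ k, ∑ m, ihess Φ x k m * pd2 Φ m j x
      = (1 : Matrix (Fin n) (Fin n) ℝ) k j := fun k => by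
    rw [← h.ihess_mul_hess hx]
    rfl
  simp only [mul_assoc, ← Finset.mul_sum, hδ, Matrix.one_apply, mul_ite, mul_one, mul_zero,
    Finset.sum_ite_eq', Finset.mem_univ, if_true]

lemma sum_calabi_mul_ricci (h : IsHessianPotential Ω Φ) (hx : x ∈ Ω) (i j : Fin n) :
    ∑ k, ∑ m, calabi Φ k i x * ihess Φ x k m * ((1/4) * calabi Φ m j x + (α/2) * pd2 Φ m j x)
      = (1/4) * ∑ k, (∑ a, ihess Φ x k a * calabi Φ a i x) * calabi Φ k j x
        + (α/2) * calabi Φ i j x := by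
  rw [h.calabi_comm hx i j, ← h.sum_calabi_mul_ihess_mul_pd2 hx i j]
  simp only [Finset.mul_sum, Finset.sum_mul, mul_add, Finset.sum_add_distrib]
  congr 1
  · rw [Finset.sum_comm]
    refine Finset.sum_congr rfl fun k _ => Finset.sum_congr rfl fun m _ => ?_
    rw [h.ihess_symm hx m k]
    ring
  · exact Finset.sum_congr rfl fun k _ => Finset.sum_congr rfl fun m _ => by ring

end IsHessianPotential

end Positivity

/-- for `det D²Φ = e^{−αΦ}` (i.e. `V = αΦ`, `W = 0`),
`Lg = 2 g ⊙ Ric_μ + 2‖∇(Φ''')‖² + 8‖R‖²`, and in particular `Lg ≥ 2 g ⊙ Ric_μ`. -/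
theorem stmt_9 {n : ℕ} (Ω : Set (Fin n → ℝ)) (hΩ : IsOpen Ω) (α : ℝ)
    (Φ : (Fin n → ℝ) → ℝ)
    (hΦ : ContDiffOn ℝ (⊤ : ℕ∞) Φ Ω) (hΦconv : ConvexOn ℝ Ω Φ)
    (hpos : ∀ x ∈ Ω, (hess Φ x).PosDef)
    (hKE : ∀ x ∈ Ω, (hess Φ x).det = Real.exp (-(α * Φ x))) :
    (∀ x ∈ Ω, ∀ i j : Fin n,
      LT2 Φ (fun y => α * Φ y) (fun _ => 0) (calabi Φ) i j x
      = (∑ k, ∑ m,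
          (calabi Φ k i x * ihess Φ x k m
              * ((1/4) * calabi Φ m j x + (α/2) * pd2 Φ m j x)
            + calabi Φ k j x * ihess Φ x k m
              * ((1/4) * calabi Φ m i x + (α/2) * pd2 Φ m i x)))
        + 2 * (∑ p, ∑ q, ∑ a, ∑ b, ∑ c, ∑ d,
            Ncal Φ p i a b x * Ncal Φ q j c d x
              * ihess Φ x p q * ihess Φ x a c * ihess Φ x b d)
        + 8 * (∑ a, ∑ b, ∑ c, ∑ p, ∑ q, ∑ r,
            Rcal Φ i a b c x * Rcal Φ j p q r x
              * ihess Φ x a p * ihess Φ x b q * ihess Φ x c r))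
    ∧ (∀ x ∈ Ω, ∀ v : Fin n → ℝ,
        0 ≤ ∑ i, ∑ j,
          (LT2 Φ (fun y => α * Φ y) (fun _ => 0) (calabi Φ) i j x
            - ∑ k, ∑ m,
              (calabi Φ k i x * ihess Φ x k m
                  * ((1/4) * calabi Φ m j x + (α/2) * pd2 Φ m j x)
                + calabi Φ k j x * ihess Φ x k m
                  * ((1/4) * calabi Φ m i x + (α/2) * pd2 Φ m i x))) * v i * v j) := by
  have h : IsHessianPotential Ω Φ := ⟨hΩ, hΦ, hpos⟩
  refine (and_iff_left_of_imp fun heq x hx v => ?_).2 fun x hx i j => ?_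
  · have hK := (h.posDef_ihess hx).posSemidef
    have hN := sum_gram_nonneg hK (fun i p a b => Ncal Φ p i a b x) v
    have hR := sum_gram_nonneg hK (fun i a b c => Rcal Φ i a b c x) v
    have h8 : (0 : ℝ) ≤ 8 := by positivity
    refine le_of_le_of_eq (add_nonneg (mul_nonneg zero_le_two hN) (mul_nonneg h8 hR)) ?_
    rw [Finset.mul_sum, Finset.mul_sum, ← Finset.sum_add_distrib]
    refine Finset.sum_congr rfl fun i _ => ?_
    rw [Finset.mul_sum, Finset.mul_sum, ← Finset.sum_add_distrib]
    refine Finset.sum_congr rfl fun j _ => ?_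
    rw [heq x hx i j, sum_comm_middle fun p q a b c d => Ncal Φ p i a b x * Ncal Φ q j c d x
      * ihess Φ x p q * ihess Φ x a c * ihess Φ x b d]
    ring
  · simp only [Finset.sum_add_distrib, h.sum_calabi_mul_ricci hx, h.sum_Ncal_mul_Ncal hx,
      h.sum_Rcal_mul_Rcal hx, h.LT2_calabi hKE hx, h.calabi_comm hx j i]
    ring
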